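/- Let r2 : ℝ → ℝ³ be twice continuously differentiable with ‖r2' s‖ ≤ v1 for all s ∈ ℝ, where 0 ≤ v1 < 1, and set w = r2', a = w' ∘ τ. Then at every point (r1, t) of G the vector field v = w ∘ τ is differentiable, with time derivative Dv = z·a and spatial partial derivatives Dᵢv = −eᵢ·z·a for i = 1,2,3. -/

import Mathlib

open scoped RealInnerProductSpace

theorem hasFDerivAt_norm_of_ne_zero {E : Type*} [NormedAddCommGroup E] [InnerProductSpace ℝ E]
    {x : E} (hx : x ≠ 0) :
    HasFDerivAt (fun y : E => ‖y‖) (innerSL ℝ (‖x‖⁻¹ • x)) x := by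
  have hx' : ‖x‖ ≠ 0 := norm_ne_zero_iff.mpr hx
  have h := (hasStrictFDerivAt_norm_sq x).hasFDerivAt.sqrt (pow_ne_zero 2 hx')
  simp only [Real.sqrt_sq (norm_nonneg _)] at h
  convert h using 1
  ext y
  simp
  field_simp

/-- The retarded time of a trajectory with speed at most `c < 1` is Lipschitz. -/
theorem abs_retardedTime_sub_le {E : Type*} [SeminormedAddCommGroup E]
    {γ : ℝ → E} {c : ℝ} (hc : c < 1)
    (hγ : ∀ s s', ‖γ s - γ s'‖ ≤ c * |s - s'|) {τ : E × ℝ → ℝ}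
    (hτ : ∀ p, τ p = p.2 - ‖p.1 - γ (τ p)‖) (p q : E × ℝ) :
    |τ p - τ q| ≤ 2 / (1 - c) * ‖p - q‖ := by
  have hnorm : |‖p.1 - γ (τ p)‖ - ‖q.1 - γ (τ q)‖| ≤ ‖p.1 - q.1‖ + c * |τ p - τ q| := by
    calc _ ≤ ‖(p.1 - γ (τ p)) - (q.1 - γ (τ q))‖ := abs_norm_sub_norm_le _ _
      _ = ‖(p.1 - q.1) - (γ (τ p) - γ (τ q))‖ := by congr 1; abel
      _ ≤ ‖p.1 - q.1‖ + ‖γ (τ p) - γ (τ q)‖ := norm_sub_le _ _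
      _ ≤ _ := by gcongr; exact hγ _ _
  have hfst : ‖p.1 - q.1‖ ≤ ‖p - q‖ := norm_fst_le (p - q)
  have hsnd : |p.2 - q.2| ≤ ‖p - q‖ := norm_snd_le (p - q)
  have hsub : τ p - τ q = (p.2 - q.2) - (‖p.1 - γ (τ p)‖ - ‖q.1 - γ (τ q)‖) := by
    linarith [hτ p, hτ q]
  have htri := abs_sub (p.2 - q.2) (‖p.1 - γ (τ p)‖ - ‖q.1 - γ (τ q)‖)
  rw [← hsub] at htri
  rw [div_mul_eq_mul_div, le_div_iff₀ (sub_pos.mpr hc)]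
  linarith

/-- Implicit differentiation of the retarded time off the trajectory. -/
theorem hasFDerivAt_retardedTime {E : Type*} [NormedAddCommGroup E] [InnerProductSpace ℝ E]
    {γ : ℝ → E} {c : ℝ} (hc : c < 1)
    (hγ : ∀ s s', ‖γ s - γ s'‖ ≤ c * |s - s'|) {τ : E × ℝ → ℝ}
    (hτ : ∀ p, τ p = p.2 - ‖p.1 - γ (τ p)‖) {p : E × ℝ} {e w : E}
    (hp : p.1 - γ (τ p) ≠ 0) (he : e = ‖p.1 - γ (τ p)‖⁻¹ • (p.1 - γ (τ p)))
    (hw : HasDerivAt γ w (τ p)) (hew : 1 - ⟪e, w⟫ ≠ 0) :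
    HasFDerivAt τ ((1 - ⟪e, w⟫)⁻¹ •
      (ContinuousLinearMap.snd ℝ E ℝ - (innerSL ℝ e).comp (ContinuousLinearMap.fst ℝ E ℝ))) p := by
  have hO : (fun q => τ q - τ p) =O[nhds p] fun q => q - p :=
    .of_bound (2 / (1 - c)) (.of_forall fun q => abs_retardedTime_sub_le hc hγ hτ q p)
  have hτc : ContinuousAt τ p := by
    rw [ContinuousAt, tendsto_iff_norm_sub_tendsto_zero]
    refine squeeze_zero (fun _ => norm_nonneg _)
      (fun q => abs_retardedTime_sub_le hc hγ hτ q p) ?_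
    have : Continuous fun q : E × ℝ => 2 / (1 - c) * ‖q - p‖ := by fun_prop
    simpa using this.tendsto p
  have hdist := (show HasFDerivAt (fun y : E => ‖y‖) (innerSL ℝ e) (p.1 - γ (τ p)) from
      he ▸ hasFDerivAt_norm_of_ne_zero hp).comp (f := fun x : E × ℝ => x.1 - γ x.2) (p.1, τ p)
    (hasFDerivAt_fst.sub (hw.hasFDerivAt.comp (p.1, τ p) hasFDerivAt_snd))
  have hlim : Filter.Tendsto (fun q : E × ℝ => (q.1, τ q)) (nhds p) (nhds (p.1, τ p)) :=
    continuousAt_fst.prodMk hτc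
  have hfst : (fun q : E × ℝ => q.1 - p.1) =O[nhds p] fun q => q - p :=
    .of_bound 1 (.of_forall fun q => by simpa using norm_fst_le (q - p))
  have ho := ((hasFDerivAt_iff_isLittleO.mp hdist).comp_tendsto hlim).trans_isBigO
    (hfst.prod_left hO)
  rw [hasFDerivAt_iff_isLittleO]
  refine (ho.const_mul_left (-(1 - ⟪e, w⟫)⁻¹)).congr_left fun q => ?_
  simp [inner_sub_right]
  have h1 := hτ p
  have h2 := hτ q
  field_simp
  linear_combination h1 - h2

/-- differentiability of the vector field `v = w ∘ τ` on `G`,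
with `Dv = z·a` and `Dᵢv = −eᵢ·z·a`. -/
theorem v_field_differential
    (r2 : ℝ → EuclideanSpace ℝ (Fin 3)) (v1 : ℝ)
    (hv0 : 0 ≤ v1) (hv1 : v1 < 1)
    (hC2 : ContDiff ℝ 2 r2) (hbd : ∀ s : ℝ, ‖deriv r2 s‖ ≤ v1)
    (τ : EuclideanSpace ℝ (Fin 3) × ℝ → ℝ)
    (hτ : ∀ p : EuclideanSpace ℝ (Fin 3) × ℝ, τ p = p.2 - ‖p.1 - r2 (τ p)‖)
    (T : EuclideanSpace ℝ (Fin 3) × ℝ → ℝ)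
    (hT : ∀ p, T p = p.2 - τ p)
    (e : EuclideanSpace ℝ (Fin 3) × ℝ → EuclideanSpace ℝ (Fin 3))
    (he : ∀ p, e p = (T p)⁻¹ • (p.1 - r2 (τ p)))
    (v : EuclideanSpace ℝ (Fin 3) × ℝ → EuclideanSpace ℝ (Fin 3))
    (hv : ∀ p, v p = deriv r2 (τ p))
    (a : EuclideanSpace ℝ (Fin 3) × ℝ → EuclideanSpace ℝ (Fin 3))
    (ha : ∀ p, a p = deriv (deriv r2) (τ p))
    (z : EuclideanSpace ℝ (Fin 3) × ℝ → ℝ)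
    (hz : ∀ p, z p = (1 - ⟪e p, v p⟫)⁻¹)
    (r1 : EuclideanSpace ℝ (Fin 3)) (t : ℝ)
    (hG : 0 < T (r1, t)) :
    ∃ L : EuclideanSpace ℝ (Fin 3) × ℝ →L[ℝ] EuclideanSpace ℝ (Fin 3),
      HasFDerivAt v L (r1, t) ∧
        ∀ (dr : EuclideanSpace ℝ (Fin 3)) (dt : ℝ),
          L (dr, dt) =
            dt • (z (r1, t) • a (r1, t)) +
              ∑ i : Fin 3, dr i • ((-(e (r1, t) i * z (r1, t))) • a (r1, t)) := by
  have hLip : ∀ s s', ‖r2 s - r2 s'‖ ≤ v1 * |s - s'| := fun s s' =>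
    convex_univ.norm_image_sub_le_of_norm_deriv_le
      (fun x _ => (hC2.differentiable (by norm_num)) x) (fun x _ => hbd x)
      (Set.mem_univ s') (Set.mem_univ s)
  have hTnorm : T (r1, t) = ‖r1 - r2 (τ (r1, t))‖ := by
    linarith [hT (r1, t), hτ (r1, t)]
  have hoff : r1 - r2 (τ (r1, t)) ≠ 0 := norm_pos_iff.mp (hTnorm ▸ hG)
  have he' := he (r1, t)
  rw [hTnorm] at he'
  have hnorm : ‖e (r1, t)‖ = 1 := by
    rw [he', norm_smul, norm_inv, norm_norm, inv_mul_cancel₀ (norm_ne_zero_iff.mpr hoff)]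
  have hinner : ⟪e (r1, t), v (r1, t)⟫ < 1 :=
    calc _ ≤ ‖e (r1, t)‖ * ‖v (r1, t)‖ := real_inner_le_norm _ _
      _ ≤ v1 := by rw [hnorm, one_mul, hv]; exact hbd _
      _ < 1 := hv1
  have hw : HasDerivAt r2 (v (r1, t)) (τ (r1, t)) := by
    rw [hv]
    exact ((hC2.differentiable (by norm_num)) _).hasDerivAt
  have hw' : HasDerivAt (deriv r2) (a (r1, t)) (τ (r1, t)) := by
    rw [ha]
    exact (hC2.differentiable_deriv_two _).hasDerivAt
  have hτ' := hasFDerivAt_retardedTime (p := (r1, t)) hv1 hLip hτ hoff he' hw (sub_pos.mpr hinner).ne'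
  rw [← hz (r1, t)] at hτ'
  refine ⟨_, (hw'.hasFDerivAt.comp (r1, t) hτ').congr_of_eventuallyEq
    (.of_forall hv), fun dr dt => ?_⟩
  simp [PiLp.inner_apply, Fin.sum_univ_three]
  module
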